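/- Let n ≥ 2, let λ > 0 be the smallest nonzero eigenvalue of H_{W,0} on (ℂ²)^{⊗n}, and let Γ be a real number with Γ·λ > n. Define H_W := Γ·H_{W,0} + I − Σ_{i=1}^n (I − Z_i)/2. Then: (i) H_W |W_n⟩ = 0 and 0 is a simple eigenvalue of H_W, so |W_n⟩ is the unique ground state of H_W with ground energy 0; (ii) every eigenvalue of H_W other than this simple eigenvalue 0 is at least min(1, Γλ + 1 − n) = 1; in particular H_W is positive semidefinite with spectral gap at least 1. -/

import Mathlib

open Matrix
open scoped Kronecker ComplexOrder

namespace QSim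

/-- Index set for the computational basis of `n` qubits. -/
abbrev QIdx (n : ℕ) := Fin n → Fin 2

/-- Operators (matrices) on the Hilbert space of `n` qubits. -/
abbrev QOp (n : ℕ) := Matrix (QIdx n) (QIdx n) ℂ

/-- The operator (`ℓ²→ℓ²`) norm of a (possibly rectangular) matrix. -/
noncomputable def opNorm {I J : Type*} [Fintype I] [Fintype J] [DecidableEq J]
    (M : Matrix I J ℂ) : ℝ :=
  ‖LinearMap.toContinuousLinearMap (Matrix.toEuclideanLin M)‖

/-- A two-qubit operator `E` placed on qubits `i` and `j` of an `n`-qubit register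
(identity elsewhere), given entrywise. -/
def twoQubitOp (n : ℕ) (i j : Fin n) (E : Fin 2 → Fin 2 → Fin 2 → Fin 2 → ℂ) : QOp n :=
  fun x y => E (x i) (x j) (y i) (y j) * (if ∀ k, k ≠ i → k ≠ j → x k = y k then 1 else 0)

/-- A single-qubit operator `E` placed on qubit `i` of an `n`-qubit register. -/
def oneQubitOp (n : ℕ) (i : Fin n) (E : Matrix (Fin 2) (Fin 2) ℂ) : QOp n :=
  fun x y => E (x i) (y i) * (if ∀ k, k ≠ i → x k = y k then 1 else 0)

/-- Sign used to build `(|01⟩ - |10⟩)/√2`. -/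
def sgnE (a b : Fin 2) : ℂ :=
  if a = 0 ∧ b = 1 then 1 else if a = 1 ∧ b = 0 then -1 else 0

/-- Entries of the two-qubit projector `P` onto `span{(|01⟩-|10⟩)/√2, |11⟩}`:
`P = (1/2)(|01⟩-|10⟩)(⟨01|-⟨10|) + |11⟩⟨11|`. -/
noncomputable def Pentry (a b c d : Fin 2) : ℂ :=
  (1 / 2) * sgnE a b * sgnE c d + (if a = 1 ∧ b = 1 ∧ c = 1 ∧ d = 1 then 1 else 0)

/-- `H_{W,0} = Σ_{i=1}^{n-1} P_{i,i+1}`. -/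
noncomputable def HW0 (n : ℕ) : QOp n :=
  ∑ i : Fin (n - 1),
    twoQubitOp n ⟨i.1, by have := i.2; omega⟩ ⟨i.1 + 1, by have := i.2; omega⟩ Pentry

/-- The all-zeros state `|0…0⟩`. -/
def ket0 (n : ℕ) : QIdx n → ℂ := fun x => if ∀ k, x k = 0 then 1 else 0

/-- The generalized W state `|W_n⟩ = n^{-1/2} Σ_i |e_i⟩`. -/
noncomputable def Wstate (n : ℕ) : QIdx n → ℂ := fun x =>
  if (Finset.univ.filter fun k => x k = 1).card = 1 then (((Real.sqrt n)⁻¹ : ℝ) : ℂ) else 0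

end QSim

namespace QSim

/-- The Pauli `Z` matrix. -/
noncomputable def Zmat : Matrix (Fin 2) (Fin 2) ℂ := !![1, 0; 0, -1]

/-- The Pauli `X` matrix. -/
noncomputable def Xmat : Matrix (Fin 2) (Fin 2) ℂ := !![0, 1; 1, 0]

/-- The W-state parent Hamiltonian `H_W = Γ·H_{W,0} + 1 - Σ_{i=1}^n (1 - Z_i)/2`. -/
noncomputable def HWham (n : ℕ) (Γ : ℝ) : QOp n :=
  (Γ : ℂ) • HW0 n + 1 - ∑ i : Fin n, oneQubitOp n i ((1 - Zmat) / 2)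

end QSim

namespace QSim

/-- The Hamming weight of a basis label. -/
def weight {n : ℕ} (x : QIdx n) : ℕ := (Finset.univ.filter fun k => x k = 1).card

theorem weight_comp_perm {n : ℕ} (x : QIdx n) (σ : Equiv.Perm (Fin n)) :
    weight (x ∘ σ) = weight x := by
  unfold weight
  exact Finset.card_bij (fun k _ => σ k) (by simp) (by simp)
    (fun b hb => ⟨σ.symm b, by simpa using hb, by simp⟩)

theorem weight_le {n : ℕ} (x : QIdx n) : weight x ≤ n := by
  simpa [weight] using Finset.card_filter_le (Finset.univ : Finset (Fin n)) fun k => x k = 1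

theorem twoQubitOp_Pentry_apply {n : ℕ} {i j : Fin n} (hij : i ≠ j) (x y : QIdx n) :
    twoQubitOp n i j Pentry x y =
      (1 / 2) * ((if y = x then 1 else 0) - (if y = x ∘ Equiv.swap i j then 1 else 0)) +
        (if x i = 1 ∧ x j = 1 then 1 else 0) * (if y = x then 1 else 0) := by
  have h₁ : y = x ↔ (∀ k, k ≠ i → k ≠ j → x k = y k) ∧ y i = x i ∧ y j = x j := by
    refine ⟨by rintro rfl; simp, fun ⟨h, hi, hj⟩ => funext fun k => ?_⟩
    by_cases hki : k = i
    · exact hki ▸ hi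
    by_cases hkj : k = j
    · exact hkj ▸ hj
    exact (h k hki hkj).symm
  have h₂ : y = x ∘ Equiv.swap i j ↔
      (∀ k, k ≠ i → k ≠ j → x k = y k) ∧ y i = x j ∧ y j = x i := by
    refine ⟨?_, fun ⟨h, hi, hj⟩ => funext fun k => ?_⟩
    · rintro rfl
      refine ⟨fun k hi hj => by simp [Equiv.swap_apply_of_ne_of_ne hi hj], by simp, by simp⟩
    by_cases hki : k = i
    · subst hki; simpa using hi
    by_cases hkj : k = j
    · subst hkj; simpa using hj
    simpa [Equiv.swap_apply_of_ne_of_ne hki hkj] using (h k hki hkj).symm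
  by_cases h : ∀ k, k ≠ i → k ≠ j → x k = y k
  · rw [and_iff_right h] at h₁ h₂
    simp only [twoQubitOp, h₁, h₂, if_pos h, mul_one]
    generalize x i = a
    generalize x j = b
    generalize y i = c
    generalize y j = d
    fin_cases a <;> fin_cases b <;> fin_cases c <;> fin_cases d <;> norm_num [Pentry, sgnE]
  · simp [twoQubitOp, h₁, h₂, h]

theorem twoQubitOp_Pentry_mulVec {n : ℕ} {i j : Fin n} (hij : i ≠ j) (v : QIdx n → ℂ)
    (x : QIdx n) :
    (twoQubitOp n i j Pentry *ᵥ v) x =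
      (1 / 2) * (v x - v (x ∘ Equiv.swap i j)) + (if x i = 1 ∧ x j = 1 then v x else 0) := by
  simp [Matrix.mulVec, dotProduct, twoQubitOp_Pentry_apply hij, add_mul, sub_mul, mul_assoc,
    Finset.sum_add_distrib, ← Finset.mul_sum]

theorem comp_swap_of_eq {n : ℕ} {i j : Fin n} {x : QIdx n} (h : x i = x j) :
    x ∘ Equiv.swap i j = x := by
  funext k
  simp only [Function.comp_apply, Equiv.swap_apply_def]
  split_ifs with h₁ h₂ <;> simp_all

theorem twoQubitOp_Pentry_isHermitian {n : ℕ} (i j : Fin n) :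
    (twoQubitOp n i j Pentry).IsHermitian := by
  ext x y
  simp only [Matrix.conjTranspose_apply, twoQubitOp, star_mul', eq_comm (a := y _)]
  congr 1
  · simp only [Pentry, sgnE]
    split_ifs <;> simp_all
  · split_ifs <;> simp

theorem twoQubitOp_Pentry_mul_self {n : ℕ} {i j : Fin n} (hij : i ≠ j) :
    twoQubitOp n i j Pentry * twoQubitOp n i j Pentry = twoQubitOp n i j Pentry := by
  refine Matrix.ext_of_mulVec_single fun y => ?_
  generalize (Pi.single y 1 : QIdx n → ℂ) = v
  funext x
  have hx : (x ∘ Equiv.swap i j) ∘ Equiv.swap i j = x := by ext k; simp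
  rw [← Matrix.mulVec_mulVec]
  simp only [twoQubitOp_Pentry_mulVec hij, hx]
  by_cases h : x i = x j
  · by_cases hj : x j = 1 <;> simp [comp_swap_of_eq h, h, hj]
  · have h₁ : ¬ (x i = 1 ∧ x j = 1) := fun ⟨a, b⟩ => h (a.trans b.symm)
    have h₂ : ¬ (x j = 1 ∧ x i = 1) := fun ⟨a, b⟩ => h (b.trans a.symm)
    simp [h₁, h₂]
    ring

theorem twoQubitOp_Pentry_posSemidef {n : ℕ} {i j : Fin n} (hij : i ≠ j) :
    (twoQubitOp n i j Pentry).PosSemidef := by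
  have h := Matrix.posSemidef_conjTranspose_mul_self (twoQubitOp n i j Pentry)
  rwa [(twoQubitOp_Pentry_isHermitian i j).eq, twoQubitOp_Pentry_mul_self hij] at h

theorem twoQubitOp_Pentry_ker {n : ℕ} {i j : Fin n} (hij : i ≠ j) {v : QIdx n → ℂ}
    (hv : twoQubitOp n i j Pentry *ᵥ v = 0) (x : QIdx n) :
    v (x ∘ Equiv.swap i j) = v x ∧ (x i = 1 → x j = 1 → v x = 0) := by
  have h := congrFun hv x
  rw [twoQubitOp_Pentry_mulVec hij] at h
  by_cases hx : x i = 1 ∧ x j = 1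
  · simpa [comp_swap_of_eq (hx.1.trans hx.2.symm), hx] using h
  · refine ⟨?_, fun a b => absurd ⟨a, b⟩ hx⟩
    simp only [hx, if_false, Pi.zero_apply] at h
    linear_combination (-2) * h

theorem HW0_isHermitian (n : ℕ) : (HW0 n).IsHermitian :=
  isSelfAdjoint_sum _ fun _ _ => twoQubitOp_Pentry_isHermitian _ _

/-- A zero mode of `H_{W,0}` is annihilated by every term of the sum. -/
theorem twoQubitOp_mulVec_eq_zero_of_HW0 {m : ℕ} {v : QIdx (m + 1) → ℂ}
    (hv : HW0 (m + 1) *ᵥ v = 0) (i : Fin m) :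
    twoQubitOp (m + 1) i.castSucc i.succ Pentry *ᵥ v = 0 := by
  have hpos (i : Fin m) : (twoQubitOp (m + 1) i.castSucc i.succ Pentry).PosSemidef :=
    twoQubitOp_Pentry_posSemidef i.castSucc_lt_succ.ne
  have hsum : ∑ i : Fin m, star v ⬝ᵥ (twoQubitOp (m + 1) i.castSucc i.succ Pentry *ᵥ v) = 0 := by
    rw [← dotProduct_sum, ← Matrix.sum_mulVec]
    exact (congrArg (star v ⬝ᵥ ·) hv).trans (dotProduct_zero _)
  rw [Finset.sum_eq_zero_iff_of_nonneg fun i _ => (hpos i).dotProduct_mulVec_nonneg v] at hsum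
  exact ((hpos i).dotProduct_mulVec_zero_iff v).1 (hsum i (Finset.mem_univ i))

theorem HW0_ker_comp_perm {m : ℕ} {v : QIdx (m + 1) → ℂ} (hv : HW0 (m + 1) *ᵥ v = 0)
    (σ : Equiv.Perm (Fin (m + 1))) (x : QIdx (m + 1)) : v (x ∘ σ) = v x := by
  have hσ : σ ∈ Submonoid.closure
      (Set.range fun i : Fin m => Equiv.swap i.castSucc i.succ) := by
    simp [Equiv.Perm.mclosure_swap_castSucc_succ]
  induction hσ using Submonoid.closure_induction generalizing x with
  | mem σ h =>
    obtain ⟨i, rfl⟩ := h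
    exact (twoQubitOp_Pentry_ker i.castSucc_lt_succ.ne
      (twoQubitOp_mulVec_eq_zero_of_HW0 hv i) x).1
  | one => rfl
  | mul σ τ _ _ h₁ h₂ => exact (h₂ (x ∘ σ)).trans (h₁ x)

theorem HW0_ker_eq_zero {m : ℕ} {v : QIdx (m + 1) → ℂ} (hv : HW0 (m + 1) *ᵥ v = 0)
    {x : QIdx (m + 1)} (hx : 1 < weight x) : v x = 0 := by
  obtain ⟨a, ha, b, hb, hab⟩ := Finset.one_lt_card.1 hx
  simp only [Finset.mem_filter, Finset.mem_univ, true_and] at ha hb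
  obtain _ | m := m
  · exact absurd (Subsingleton.elim (α := Fin 1) a b) hab
  obtain ⟨σ, hσ⟩ := (MulAction.is_two_pretransitive_iff (G := Equiv.Perm (Fin (m + 2)))).1
    (Equiv.Perm.isMultiplyPretransitive (Fin (m + 2)) 2)
    (0 : Fin (m + 1)).castSucc_lt_succ.ne hab
  rw [← HW0_ker_comp_perm hv σ x]
  refine (twoQubitOp_Pentry_ker (0 : Fin (m + 1)).castSucc_lt_succ.ne
    (twoQubitOp_mulVec_eq_zero_of_HW0 hv 0) _).2 ?_ ?_
  · exact (congrArg x hσ.1).trans ha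
  · exact (congrArg x hσ.2).trans hb

theorem eq_single_of_weight_eq_one {n : ℕ} {x : QIdx n} (hx : weight x = 1) :
    ∃ a, x = Pi.single a 1 := by
  obtain ⟨a, ha⟩ := Finset.card_eq_one.1 hx
  refine ⟨a, funext fun k => ?_⟩
  have hk : x k = 1 ↔ k = a := by simpa using Finset.ext_iff.1 ha k
  by_cases h : k = a
  · subst h; simpa using hk
  · rw [Pi.single_eq_of_ne h]
    have := mt hk.1 h
    omega

theorem HW0_ker_eq_of_weight_one {m : ℕ} {v : QIdx (m + 1) → ℂ} (hv : HW0 (m + 1) *ᵥ v = 0)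
    {x y : QIdx (m + 1)} (hx : weight x = 1) (hy : weight y = 1) : v x = v y := by
  obtain ⟨a, rfl⟩ := eq_single_of_weight_eq_one hx
  obtain ⟨b, rfl⟩ := eq_single_of_weight_eq_one hy
  rw [← HW0_ker_comp_perm hv (Equiv.swap a b)]
  congr 1
  funext k
  simp only [Function.comp_apply, Pi.single_apply, Equiv.swap_apply_def]
  split_ifs <;> simp_all

theorem fin_mk_ne_mk_succ {n k : ℕ} (h₁ : k < n) (h₂ : k + 1 < n) :
    (⟨k, h₁⟩ : Fin n) ≠ ⟨k + 1, h₂⟩ := by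
  simp

/-- `H_{W,0}` conserves the Hamming weight. -/
theorem HW0_mulVec_sector {n : ℕ} (v : QIdx n → ℂ) (k : ℕ) :
    HW0 n *ᵥ (fun x => if weight x = k then v x else 0) =
      fun x => if weight x = k then (HW0 n *ᵥ v) x else 0 := by
  funext x
  simp only [HW0, Matrix.sum_mulVec, Finset.sum_apply]
  simp only [twoQubitOp_Pentry_mulVec (fin_mk_ne_mk_succ _ _), weight_comp_perm]
  split_ifs <;> simp

theorem HW0_mulVec_Wstate (n : ℕ) : HW0 n *ᵥ Wstate n = 0 := by
  funext x
  simp only [HW0, Matrix.sum_mulVec, Finset.sum_apply]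
  refine Finset.sum_eq_zero fun i _ => ?_
  have hW (y : QIdx n) :
      Wstate n y = if weight y = 1 then (((Real.sqrt n)⁻¹ : ℝ) : ℂ) else 0 := rfl
  rw [twoQubitOp_Pentry_mulVec (fin_mk_ne_mk_succ _ _), hW, hW, weight_comp_perm, sub_self,
    mul_zero, zero_add]
  split_ifs with h₁ h₂
  · obtain ⟨a, rfl⟩ := eq_single_of_weight_eq_one h₂
    simp only [Pi.single_apply, ite_eq_left_iff, zero_ne_one, imp_false, not_not] at h₁
    exact absurd (h₁.1.trans h₁.2.symm) (fin_mk_ne_mk_succ _ _)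
  all_goals rfl

theorem oneQubitOp_number (n : ℕ) (i : Fin n) :
    oneQubitOp n i ((1 - Zmat) / 2) = Matrix.diagonal fun x => if x i = 1 then 1 else 0 := by
  have h : (1 - Zmat) / 2 = !![0, 0; 0, 1] := by
    have h2 : (2 : Matrix (Fin 2) (Fin 2) ℂ)⁻¹ = !![1 / 2, 0; 0, 1 / 2] := by
      refine Matrix.inv_eq_right_inv ?_
      rw [two_mul]
      ext a b
      fin_cases a <;> fin_cases b <;> norm_num [Matrix.mul_apply]
    rw [div_eq_mul_inv, h2, Zmat]
    ext a b
    fin_cases a <;> fin_cases b <;> norm_num [Matrix.mul_apply]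
  rw [h]
  ext x y
  have hxy : x = y ↔ (∀ k, k ≠ i → x k = y k) ∧ x i = y i := by
    refine ⟨by rintro rfl; simp, fun ⟨hk, hi⟩ => funext fun k => ?_⟩
    by_cases hki : k = i
    · exact hki ▸ hi
    · exact hk k hki
  by_cases hk : ∀ k, k ≠ i → x k = y k
  · rw [and_iff_right hk] at hxy
    simp only [oneQubitOp, Matrix.diagonal_apply, hxy, if_pos hk, mul_one]
    generalize x i = a
    generalize y i = b
    fin_cases a <;> fin_cases b <;> simp
  · simp [oneQubitOp, hxy, hk]

theorem HWham_eq (n : ℕ) (Γ : ℝ) :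
    HWham n Γ = (Γ : ℂ) • HW0 n + 1 - Matrix.diagonal fun x => (weight x : ℂ) := by
  rw [HWham]
  congr 1
  ext x y
  simp only [oneQubitOp_number, Matrix.sum_apply, Matrix.diagonal_apply, weight]
  split_ifs <;> simp

theorem HWham_mulVec_apply (n : ℕ) (Γ : ℝ) (v : QIdx n → ℂ) (x : QIdx n) :
    (HWham n Γ *ᵥ v) x = Γ * (HW0 n *ᵥ v) x + v x - weight x * v x := by
  simp [HWham_eq, Matrix.sub_mulVec, Matrix.add_mulVec, Matrix.smul_mulVec,
    Matrix.mulVec_diagonal]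

theorem HWham_isHermitian (n : ℕ) (Γ : ℝ) : (HWham n Γ).IsHermitian := by
  rw [HWham_eq]
  refine ((IsSelfAdjoint.smul ?_ (HW0_isHermitian n)).add Matrix.isHermitian_one).sub ?_
  · exact Complex.conj_ofReal Γ
  · exact Matrix.isHermitian_diagonal_of_self_adjoint _ (by ext x; simp)

theorem HWham_mulVec_Wstate (n : ℕ) (Γ : ℝ) : HWham n Γ *ᵥ Wstate n = 0 := by
  funext x
  rw [HWham_mulVec_apply, HW0_mulVec_Wstate]
  by_cases h : weight x = 1
  · simp [h]
  · have : Wstate n x = 0 := if_neg h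
    simp [this]

/-- The spectrum of a complex matrix consists of the values having an eigenvector. -/
theorem mem_spectrum_iff_exists_mulVec {ι : Type*} [Fintype ι] [DecidableEq ι]
    {A : Matrix ι ι ℂ} {μ : ℂ} : μ ∈ spectrum ℂ A ↔ ∃ v, v ≠ 0 ∧ A *ᵥ v = μ • v := by
  rw [← Matrix.spectrum_toLin', ← Module.End.hasEigenvalue_iff_mem_spectrum]
  constructor
  · intro h
    obtain ⟨v, hv⟩ := h.exists_hasEigenvector
    exact ⟨v, hv.2, by simpa using hv.apply_eq_smul⟩
  · rintro ⟨v, hv, h⟩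
    exact Module.End.hasEigenvalue_of_hasEigenvector
      ⟨Module.End.mem_eigenspace_iff.2 (by simpa using h), hv⟩

theorem HW0_mulVec_sector_of_HWham {n : ℕ} {Γ μ : ℝ} (hΓ : Γ ≠ 0) {v : QIdx n → ℂ}
    (hv : HWham n Γ *ᵥ v = (μ : ℂ) • v) (k : ℕ) :
    HW0 n *ᵥ (fun x => if weight x = k then v x else 0) =
      (((μ - 1 + k) / Γ : ℝ) : ℂ) • fun x => if weight x = k then v x else 0 := by
  rw [HW0_mulVec_sector]
  funext x
  have h := congrFun hv x
  rw [HWham_mulVec_apply] at h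
  have hΓ' : (Γ : ℂ) ≠ 0 := by exact_mod_cast hΓ
  simp only [Pi.smul_apply, smul_eq_mul] at h ⊢
  split_ifs with hk
  · subst hk
    push_cast
    field_simp
    linear_combination h
  · simp

/-- An eigenvector of `H_W` of eigenvalue below `1` lives in the weight-one sector, where it
is a zero mode of `H_{W,0}`. -/
theorem HWham_eigenvector {n : ℕ} (hn : n ≠ 0) {lam : ℝ} (hlam : 0 < lam)
    (hmin : ∀ μ : ℝ, (μ : ℂ) ∈ spectrum ℂ (HW0 n) → μ ≠ 0 → lam ≤ μ)
    {Γ : ℝ} (hΓ : (n : ℝ) < Γ * lam) {μ : ℝ} (hμ : μ < 1) {v : QIdx n → ℂ}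
    (hv : HWham n Γ *ᵥ v = (μ : ℂ) • v) {x : QIdx n} (hx : v x ≠ 0) :
    weight x = 1 ∧ μ = 0 := by
  have hΓ₀ : 0 < Γ := pos_of_mul_pos_left ((Nat.cast_nonneg n).trans_lt hΓ) hlam.le
  have hw := HW0_mulVec_sector_of_HWham hΓ₀.ne' hv (weight x)
  set w : QIdx n → ℂ := fun y => if weight y = weight x then v y else 0 with hw_def
  have hwx : w x ≠ 0 := by simpa [hw_def] using hx
  have hw₀ : w ≠ 0 := fun h => hwx (congrFun h x)
  have hle : (weight x : ℝ) ≤ n := by exact_mod_cast weight_le x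
  have hzero : (μ - 1 + weight x) / Γ = 0 := by
    by_contra h₀
    have h := hmin _ (mem_spectrum_iff_exists_mulVec.2 ⟨w, hw₀, hw⟩) h₀
    rw [le_div_iff₀ hΓ₀] at h
    linarith
  rw [hzero] at hw
  have hμx : μ - 1 + weight x = 0 := (div_eq_zero_iff.1 hzero).resolve_right hΓ₀.ne'
  obtain ⟨m, rfl⟩ := Nat.exists_eq_succ_of_ne_zero hn
  have h₁ : weight x ≤ 1 := by
    by_contra! h
    exact hwx (HW0_ker_eq_zero (by simpa using hw) h)
  have h₂ : weight x ≠ 0 := by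
    intro h
    rw [h, Nat.cast_zero] at hμx
    linarith
  have h₃ : weight x = 1 := by omega
  exact ⟨h₃, by rw [h₃] at hμx; push_cast at hμx; linarith⟩

theorem weight_single {n : ℕ} (a : Fin n) : weight (Pi.single a 1 : QIdx n) = 1 := by
  refine Finset.card_eq_one.2 ⟨a, ?_⟩
  ext k
  simp [Pi.single_apply]

theorem ker_HWham {n : ℕ} (hn : n ≠ 0) {lam : ℝ} (hlam : 0 < lam)
    (hmin : ∀ μ : ℝ, (μ : ℂ) ∈ spectrum ℂ (HW0 n) → μ ≠ 0 → lam ≤ μ)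
    {Γ : ℝ} (hΓ : (n : ℝ) < Γ * lam) :
    LinearMap.ker (HWham n Γ).mulVecLin = ℂ ∙ Wstate n := by
  refine le_antisymm (fun v hv => ?_) ?_
  · have hv' : HWham n Γ *ᵥ v = ((0 : ℝ) : ℂ) • v := by simpa using hv
    have hΓ₀ : 0 < Γ := pos_of_mul_pos_left ((Nat.cast_nonneg n).trans_lt hΓ) hlam.le
    have hsupp {x : QIdx n} (hx : weight x ≠ 1) : v x = 0 := by
      by_contra h
      exact hx (HWham_eigenvector hn hlam hmin hΓ zero_lt_one hv' h).1
    have hsec : (fun x => if weight x = 1 then v x else 0) = v := by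
      funext x
      split_ifs with h
      · rfl
      · exact (hsupp h).symm
    have hker : HW0 n *ᵥ v = 0 := by
      simpa [hsec] using HW0_mulVec_sector_of_HWham hΓ₀.ne' hv' 1
    obtain ⟨m, rfl⟩ := Nat.exists_eq_succ_of_ne_zero hn
    refine Submodule.mem_span_singleton.2
      ⟨(Real.sqrt (m + 1 : ℕ) : ℂ) * v (Pi.single 0 1), funext fun x => ?_⟩
    have hs : (Real.sqrt (m + 1 : ℕ) : ℂ) ≠ 0 := by
      exact_mod_cast (Real.sqrt_pos.2 (by positivity)).ne'
    by_cases h : weight x = 1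
    · have hW : Wstate (m + 1) x = (((Real.sqrt (m + 1 : ℕ))⁻¹ : ℝ) : ℂ) := if_pos h
      rw [Pi.smul_apply, hW, HW0_ker_eq_of_weight_one hker h (weight_single 0), smul_eq_mul,
        Complex.ofReal_inv]
      field_simp
    · have hW : Wstate (m + 1) x = 0 := if_neg h
      simp [hW, hsupp h]
  · rw [Submodule.span_singleton_le_iff_mem]
    exact HWham_mulVec_Wstate n Γ

theorem Wstate_ne_zero {n : ℕ} (hn : n ≠ 0) : Wstate n ≠ 0 := by
  intro h
  have h₁ := congrFun h (Pi.single ⟨0, Nat.pos_of_ne_zero hn⟩ 1)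
  have h₂ : Wstate n (Pi.single ⟨0, Nat.pos_of_ne_zero hn⟩ 1) = (((Real.sqrt n)⁻¹ : ℝ) : ℂ) :=
    if_pos (weight_single _)
  simp [h₂, hn] at h₁

/-- If `λ > 0` is the smallest nonzero eigenvalue of `H_{W,0}` and
`Γ·λ > n`, then `H_W = Γ·H_{W,0} + 1 - Σ_i (1-Z_i)/2` annihilates `|W_n⟩`, `0` is a simple
eigenvalue (so `|W_n⟩` is the unique ground state, of energy `0`), every other eigenvalue is
at least `1`, and `H_W` is positive semidefinite with spectral gap at least `1`. -/
theorem HWham_parent (n : ℕ) (hn : 2 ≤ n) (lam : ℝ) (hlam_pos : 0 < lam)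
    (hlam_mem : (lam : ℂ) ∈ spectrum ℂ (HW0 n))
    (hlam_min : ∀ μ : ℝ, (μ : ℂ) ∈ spectrum ℂ (HW0 n) → μ ≠ 0 → lam ≤ μ)
    (Γ : ℝ) (hΓ : (n : ℝ) < Γ * lam) :
    (HWham n Γ) *ᵥ Wstate n = 0 ∧
    Module.finrank ℂ (LinearMap.ker (HWham n Γ).mulVecLin) = 1 ∧
    (∀ μ : ℝ, (μ : ℂ) ∈ spectrum ℂ (HWham n Γ) → μ ≠ 0 → 1 ≤ μ) ∧
    (HWham n Γ).PosSemidef := by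
  have hn₀ : n ≠ 0 := by omega
  have hgap (μ : ℝ) (hμ : (μ : ℂ) ∈ spectrum ℂ (HWham n Γ)) (hμ₀ : μ ≠ 0) : 1 ≤ μ := by
    by_contra! h
    obtain ⟨v, hv₀, hv⟩ := mem_spectrum_iff_exists_mulVec.1 hμ
    obtain ⟨x, hx⟩ := Function.ne_iff.1 hv₀
    exact hμ₀ (HWham_eigenvector hn₀ hlam_pos hlam_min hΓ h hv hx).2
  refine ⟨HWham_mulVec_Wstate n Γ, ?_, hgap, ?_⟩
  · rw [ker_HWham hn₀ hlam_pos hlam_min hΓ, finrank_span_singleton (Wstate_ne_zero hn₀)]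
  · refine (HWham_isHermitian n Γ).posSemidef_iff_eigenvalues_nonneg.2 fun i => ?_
    by_cases h : (HWham_isHermitian n Γ).eigenvalues i = 0
    · exact h.ge
    · refine zero_le_one.trans (hgap _ ?_ h)
      rw [(HWham_isHermitian n Γ).spectrum_eq_image_range]
      exact ⟨_, ⟨i, rfl⟩, rfl⟩

end QSim
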